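/- Sufficient condition for sure loss: fix A ∈ F. If Σ_{j : E_j ≠ ∅} B_low(A|E_j) · q_j > 𝒫_up(A), then 𝒫'_low(A) > 𝒫_up(A); and if Σ_{j : E_j ≠ ∅} B_up(A|E_j) · q_j < 𝒫_low(A), then 𝒫'_up(A) < 𝒫_low(A). In either case the updated set exhibits sure loss with respect to 𝒫 at A. -/

import Mathlib

open MeasureTheory Finset
open scoped Classical

variable {Ω : Type*} [MeasurableSpace Ω]

/-- Lower probability of a set of probability measures: `𝒬_low(A) := inf_{P ∈ 𝒬} P(A)`. -/
noncomputable def lowProb (𝒮 : Set (Measure Ω)) (A : Set Ω) : ℝ :=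
  ⨅ P : 𝒮, ((P : Measure Ω) A).toReal

/-- Upper probability of a set of probability measures: `𝒬_up(A) := sup_{P ∈ 𝒬} P(A)`. -/
noncomputable def upProb (𝒮 : Set (Measure Ω)) (A : Set Ω) : ℝ :=
  ⨆ P : 𝒮, ((P : Measure Ω) A).toReal

/-- The Jeffrey (DPK) update of `P` with respect to the partition `E` and weights `q`:
`P'(A) := ∑_{j : E_j ≠ ∅} (P(A ∩ E_j)/P(E_j)) · q_j`. -/
noncomputable def jUpdate (P : Measure Ω) {m : ℕ} (E : Fin m → Set Ω)
    (q : Fin m → ℝ) (A : Set Ω) : ℝ :=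
  ∑ j ∈ Finset.univ.filter (fun j => E j ≠ ∅),
    ((P (A ∩ E j)).toReal / (P (E j)).toReal) * q j

/-- Lower probability of the updated set `𝒮' = {P' : P ∈ 𝒮}`. -/
noncomputable def jLow (𝒮 : Set (Measure Ω)) {m : ℕ} (E : Fin m → Set Ω)
    (q : Fin m → ℝ) (A : Set Ω) : ℝ :=
  ⨅ P : 𝒮, jUpdate (P : Measure Ω) E q A

/-- Upper probability of the updated set `𝒮' = {P' : P ∈ 𝒮}`. -/
noncomputable def jUp (𝒮 : Set (Measure Ω)) {m : ℕ} (E : Fin m → Set Ω)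
    (q : Fin m → ℝ) (A : Set Ω) : ℝ :=
  ⨆ P : 𝒮, jUpdate (P : Measure Ω) E q A

/-- Generalized Bayes conditional lower probability:
`B_low(A|B) := inf_{P ∈ 𝒮} P(A ∩ B)/P(B)`. -/
noncomputable def bayesLow (𝒮 : Set (Measure Ω)) (A B : Set Ω) : ℝ :=
  ⨅ P : 𝒮, ((P : Measure Ω) (A ∩ B)).toReal / ((P : Measure Ω) B).toReal

/-- Generalized Bayes conditional upper probability:
`B_up(A|B) := sup_{P ∈ 𝒮} P(A ∩ B)/P(B)`. -/
noncomputable def bayesUp (𝒮 : Set (Measure Ω)) (A B : Set Ω) : ℝ :=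
  ⨆ P : 𝒮, ((P : Measure Ω) (A ∩ B)).toReal / ((P : Measure Ω) B).toReal

/-- Geometric conditional lower probability: `G_low(A|B) := 𝒮_low(A ∩ B)/𝒮_low(B)`. -/
noncomputable def geomLow (𝒮 : Set (Measure Ω)) (A B : Set Ω) : ℝ :=
  lowProb 𝒮 (A ∩ B) / lowProb 𝒮 B

/-- Geometric conditional upper probability: `G_up(A|B) := 𝒮_up(A ∩ B)/𝒮_up(B)`. -/
noncomputable def geomUp (𝒮 : Set (Measure Ω)) (A B : Set Ω) : ℝ :=
  upProb 𝒮 (A ∩ B) / upProb 𝒮 B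

lemma toReal_inter_div_toReal_nonneg (P : Measure Ω) (A B : Set Ω) :
    0 ≤ (P (A ∩ B)).toReal / (P B).toReal := by
  positivity

lemma toReal_inter_div_toReal_le_one (P : Measure Ω) [IsFiniteMeasure P] (A B : Set Ω) :
    (P (A ∩ B)).toReal / (P B).toReal ≤ 1 :=
  div_le_one_of_le₀
    (ENNReal.toReal_mono (measure_ne_top P B) (measure_mono Set.inter_subset_right))
    ENNReal.toReal_nonneg

/-- The Jeffrey mixture of the Bayes lower probabilities is dominated by the lower updated
probability. -/
lemma sum_bayesLow_mul_le_jLow {𝒮 : Set (Measure Ω)} (hne : 𝒮.Nonempty) {m : ℕ}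
    (E : Fin m → Set Ω) {q : Fin m → ℝ} (hq : ∀ j, 0 ≤ q j) (A : Set Ω) :
    ∑ j ∈ Finset.univ.filter (fun j => E j ≠ ∅), bayesLow 𝒮 A (E j) * q j ≤ jLow 𝒮 E q A := by
  have : Nonempty 𝒮 := hne.to_subtype
  refine le_ciInf fun P => Finset.sum_le_sum fun j _ => mul_le_mul_of_nonneg_right ?_ (hq j)
  refine ciInf_le ⟨0, ?_⟩ P
  rintro _ ⟨Q, rfl⟩
  exact toReal_inter_div_toReal_nonneg _ _ _

/-- The Jeffrey mixture of the Bayes upper probabilities dominates the upper updated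
probability. -/
lemma jUp_le_sum_bayesUp_mul {𝒮 : Set (Measure Ω)} (hne : 𝒮.Nonempty)
    (hfin : ∀ P ∈ 𝒮, IsFiniteMeasure P) {m : ℕ}
    (E : Fin m → Set Ω) {q : Fin m → ℝ} (hq : ∀ j, 0 ≤ q j) (A : Set Ω) :
    jUp 𝒮 E q A ≤ ∑ j ∈ Finset.univ.filter (fun j => E j ≠ ∅), bayesUp 𝒮 A (E j) * q j := by
  have : Nonempty 𝒮 := hne.to_subtype
  refine ciSup_le fun P => Finset.sum_le_sum fun j _ => mul_le_mul_of_nonneg_right ?_ (hq j)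
  refine le_ciSup (f := fun Q : 𝒮 => ((Q : Measure Ω) (A ∩ E j)).toReal /
    ((Q : Measure Ω) (E j)).toReal) ⟨1, ?_⟩ P
  rintro _ ⟨Q, rfl⟩
  have := hfin Q Q.2
  exact toReal_inter_div_toReal_le_one _ _ _

/-- sufficient condition for sure loss at `A`: if
`∑ B_low(A|E_j) q_j > 𝒮_up(A)` then `𝒮'_low(A) > 𝒮_up(A)`; and if
`∑ B_up(A|E_j) q_j < 𝒮_low(A)` then `𝒮'_up(A) < 𝒮_low(A)`. -/
theorem sure_loss_sufficient
    (𝒮 : Set (Measure Ω)) (h𝒮ne : 𝒮.Nonempty)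
    (h𝒮prob : ∀ P ∈ 𝒮, IsProbabilityMeasure P)
    {m : ℕ} (E : Fin m → Set Ω) (hEmeas : ∀ j, MeasurableSet (E j))
    (hEdisj : Pairwise (Function.onFun Disjoint E))
    (hEcover : (⋃ j, E j) = Set.univ)
    (q : Fin m → ℝ) (hq0 : ∀ j, 0 ≤ q j) (hq1 : ∑ j, q j = 1)
    (hqempty : ∀ j, E j = ∅ → q j = 0)
    (hpos : ∀ P ∈ 𝒮, ∀ j, E j ≠ ∅ → 0 < (P : Measure Ω) (E j))
    (A : Set Ω) (hA : MeasurableSet A) :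
    (upProb 𝒮 A
        < ∑ j ∈ Finset.univ.filter (fun j => E j ≠ ∅), bayesLow 𝒮 A (E j) * q j →
      upProb 𝒮 A < jLow 𝒮 E q A) ∧
    ((∑ j ∈ Finset.univ.filter (fun j => E j ≠ ∅), bayesUp 𝒮 A (E j) * q j)
        < lowProb 𝒮 A →
      jUp 𝒮 E q A < lowProb 𝒮 A) := by
  exact ⟨fun h => h.trans_le (sum_bayesLow_mul_le_jLow h𝒮ne E hq0 A),
    fun h => (jUp_le_sum_bayesUp_mul h𝒮ne
      (fun P hP => have := h𝒮prob P hP; inferInstance) E hq0 A).trans_lt h⟩
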